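/- Let H0 be a hierarchy on [n] with induced triplet set T0. Let T be the random subset of T0 in which, independently for each pair of triplets {(i,j,k),(j,i,k)} ⊆ T0 with i<j, both triplets are included with probability p ∈ (0,1]. Let T' be obtained from T by independently keeping each triplet (i,j,k) ∈ T unchanged with probability 1−δ and replacing it with (i,k,j) with probability δ, for a fixed flipping probability δ ∈ (0, 1/2). For any α > 0 and 0 < ε < 1/2, if n > 8/ε and p > 2¹²·(α+2)·log n / (n·ε²·(1−2δ)²), then with probability at least 1 − n^{−α}, max_{H} Trev(H, T') ≥ (1−ε)·Trev(H0, T0), where the maximum is over all hierarchies H on [n] and the left-hand revenue of H is evaluated with respect to T0 via the maximizing tree (i.e., the maximizer Ĥ of Trev(H,T') satisfies Trev(Ĥ, T0) ≥ (1−ε)·Trev(H0, T0)). -/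

import Mathlib

open Finset MeasureTheory

namespace CompHC

/-- A rooted binary tree with leaves labelled by elements of `Fin n`. -/
inductive HTree (n : ℕ) : Type
  | leaf (i : Fin n) : HTree n
  | node (l r : HTree n) : HTree n

namespace HTree

/-- The list of leaf labels of a tree. -/
def leaves {n : ℕ} : HTree n → List (Fin n)
  | .leaf i => [i]
  | .node l r => l.leaves ++ r.leaves

/-- The number of leaves of a tree. -/
def size {n : ℕ} (t : HTree n) : ℕ := t.leaves.length

/-- `|H(i ∨ j)|`: the number of leaves of the smallest subtree containing both `i` and `j`. -/
def lcaSize {n : ℕ} : HTree n → Fin n → Fin n → ℕ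
  | .leaf _, _, _ => 1
  | .node l r, i, j =>
      if i ∈ l.leaves ∧ j ∈ l.leaves then l.lcaSize i j
      else if i ∈ r.leaves ∧ j ∈ r.leaves then r.lcaSize i j
      else l.size + r.size

/-- Sum of `f |N1| |N2|` over the internal nodes `N` of the tree, `N1, N2` its children. -/
def internalSum {n : ℕ} (f : ℕ → ℕ → ℕ) : HTree n → ℕ
  | .leaf _ => 0
  | .node l r => f l.size r.size + l.internalSum f + r.internalSum f

end HTree

/-- A hierarchy on `[n]`: every object appears exactly once as a leaf. -/
def IsHierarchy {n : ℕ} (t : HTree n) : Prop :=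
  t.leaves.Nodup ∧ ∀ i : Fin n, i ∈ t.leaves

abbrev Triplet (n : ℕ) := Fin n × Fin n × Fin n
abbrev Quadruplet (n : ℕ) := Fin n × Fin n × Fin n × Fin n

/-- The entries of a triplet are pairwise distinct. -/
def distinctTriplet {n : ℕ} (t : Triplet n) : Prop :=
  t.1 ≠ t.2.1 ∧ t.1 ≠ t.2.2 ∧ t.2.1 ≠ t.2.2

/-- A quadruplet `(i,j,k,l)` satisfies `i<j`, `k<l`, `(i,j) ≠ (k,l)`. -/
def validQuadruplet {n : ℕ} (q : Quadruplet n) : Prop :=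
  q.1 < q.2.1 ∧ q.2.2.1 < q.2.2.2 ∧ (q.1, q.2.1) ≠ (q.2.2.1, q.2.2.2)

/-- Triplet revenue `Trev(H,T) = Σ_{(i,j,k)∈T} (|H(i∨k)| − |H(i∨j)|)`. -/
def Trev {n : ℕ} (H : HTree n) (T : Finset (Triplet n)) : ℤ :=
  ∑ t ∈ T, ((H.lcaSize t.1 t.2.2 : ℤ) - (H.lcaSize t.1 t.2.1 : ℤ))

/-- Quadruplet revenue `Qrev(H,Q) = Σ_{(i,j,k,l)∈Q} (|H(k∨l)| − |H(i∨j)|)`. -/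
def Qrev {n : ℕ} (H : HTree n) (Q : Finset (Quadruplet n)) : ℤ :=
  ∑ q ∈ Q, ((H.lcaSize q.2.2.1 q.2.2.2 : ℤ) - (H.lcaSize q.1 q.2.1 : ℤ))

/-- The set of pairs `(i,j)` with `i < j`. -/
def pairs (n : ℕ) : Finset (Fin n × Fin n) :=
  Finset.univ.filter fun p => p.1 < p.2

/-- Dasgupta's cost `Dcost(H,s) = Σ_{i<j} s_{ij}·|H(i∨j)|`. -/
noncomputable def Dcost {n : ℕ} (H : HTree n) (s : Fin n → Fin n → ℝ) : ℝ :=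
  ∑ p ∈ pairs n, s p.1 p.2 * (H.lcaSize p.1 p.2 : ℝ)

/-- The AddS3 similarity computed from a triplet set. -/
def sAddS3 {n : ℕ} (T : Finset (Triplet n)) (i j : Fin n) : ℤ :=
  ∑ k ∈ Finset.univ.filter (fun k : Fin n => k ≠ i ∧ k ≠ j),
    (((if (i, j, k) ∈ T then 1 else 0) - (if (i, k, j) ∈ T then 1 else 0)
      + (if (j, i, k) ∈ T then 1 else 0) - (if (j, k, i) ∈ T then 1 else 0) : ℤ))

/-- The AddS4 similarity computed from a quadruplet set. -/
def sAddS4 {n : ℕ} (Q : Finset (Quadruplet n)) (i j : Fin n) : ℤ :=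
  ∑ p ∈ (pairs n).filter (fun p => p ≠ (i, j)),
    (((if (i, j, p.1, p.2) ∈ Q then 1 else 0)
      - (if (p.1, p.2, i, j) ∈ Q then 1 else 0) : ℤ))

/-- The triplet set induced by a hierarchy `H0`:
`T0 = {(i,j,k) : i,j,k pairwise distinct, |H0(i∨j)| < min(|H0(i∨k)|, |H0(j∨k)|)}`. -/
def inducedTriplets {n : ℕ} (H : HTree n) : Finset (Triplet n) :=
  Finset.univ.filter fun t : Triplet n =>
    t.1 ≠ t.2.1 ∧ t.1 ≠ t.2.2 ∧ t.2.1 ≠ t.2.2 ∧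
    H.lcaSize t.1 t.2.1 < min (H.lcaSize t.1 t.2.2) (H.lcaSize t.2.1 t.2.2)


/-- Bernoulli measure on `Bool` with success probability `p`. -/
noncomputable def bern (p : ℝ) : Measure Bool :=
  (ENNReal.ofReal p) • Measure.dirac true + (ENNReal.ofReal (1 - p)) • Measure.dirac false

/-- Product measure of i.i.d. Bernoulli(p) coins, one for each pair of triplets
`{(i,j,k),(j,i,k)}` (indexed by triplets; only keys `(i,j,k)` with `i ≤ j` are used). -/
noncomputable def sampleMeasure (n : ℕ) (p : ℝ) : Measure (Triplet n → Bool) :=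
  Measure.pi fun _ => bern p

/-- The common key of the pair of triplets `{(i,j,k),(j,i,k)}`. -/
def pairKey {n : ℕ} (t : Triplet n) : Triplet n := (min t.1 t.2.1, max t.1 t.2.1, t.2.2)

/-- The random subset `T ⊆ T0`: the pair `{(i,j,k),(j,i,k)}` is included iff its coin is true. -/
def sampledT {n : ℕ} (H0 : HTree n) (ω : Triplet n → Bool) : Finset (Triplet n) :=
  (inducedTriplets H0).filter fun t => ω (pairKey t) = true

/-- The key of the flipping coin `ζ^i_{jk}` for the triplets `(i,j,k)` and `(i,k,j)`. -/
def flipKey {n : ℕ} (t : Triplet n) : Triplet n := (t.1, min t.2.1 t.2.2, max t.2.1 t.2.2)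

/-- Flipping a triplet: `(i,j,k) ↦ (i,k,j)`. -/
def flipTriplet {n : ℕ} (t : Triplet n) : Triplet n := (t.1, t.2.2, t.2.1)

/-- Product measure: independent Bernoulli(p) sampling coins (left index) and
Bernoulli(δ) flipping coins (right index). -/
noncomputable def noisyMeasure (n : ℕ) (p δ : ℝ) :
    Measure ((Triplet n ⊕ Triplet n) → Bool) :=
  Measure.pi fun idx => Sum.elim (fun _ : Triplet n => bern p) (fun _ : Triplet n => bern δ) idx

/-- The noisy random triplet set `T'`: sample pairs from `T0` with probability `p`, then flip
each sampled triplet `(i,j,k)` to `(i,k,j)` independently with probability `δ`. -/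
def noisySampledT {n : ℕ} (H0 : HTree n) (ω : (Triplet n ⊕ Triplet n) → Bool) :
    Finset (Triplet n) :=
  ((inducedTriplets H0).filter fun t => ω (Sum.inl (pairKey t)) = true).image
    fun t => if ω (Sum.inr (flipKey t)) = true then flipTriplet t else t

namespace HTree

variable {n : ℕ}

lemma one_le_size (t : HTree n) : 1 ≤ t.size := by
  induction t with
  | leaf i => simp [size, leaves]
  | node l r hl hr => simp only [size, leaves, List.length_append] at *; omega

lemma one_le_lcaSize (t : HTree n) (i j : Fin n) : 1 ≤ t.lcaSize i j := by
  induction t with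
  | leaf i => simp [lcaSize]
  | node l r hl hr =>
    have := l.one_le_size
    simp only [lcaSize]
    split_ifs <;> omega

lemma lcaSize_le_size (t : HTree n) (i j : Fin n) : t.lcaSize i j ≤ t.size := by
  induction t with
  | leaf i => simp [lcaSize, size, leaves]
  | node l r hl hr =>
    have h : (node l r).size = l.size + r.size := by simp [size, leaves]
    simp only [lcaSize, h]
    split_ifs <;> omega

lemma size_node (l r : HTree n) : (node l r).size = l.size + r.size := by
  simp [size, leaves]

/-- The leaf labels of a tree as a finset. -/
def support (t : HTree n) : Finset (Fin n) := t.leaves.toFinset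

lemma support_node (l r : HTree n) : (node l r).support = l.support ∪ r.support := by
  simp [support, leaves]

lemma card_support {t : HTree n} (ht : t.leaves.Nodup) : t.support.card = t.size :=
  List.toFinset_card_of_nodup ht

lemma disjoint_support {l r : HTree n} (h : (node l r).leaves.Nodup) :
    Disjoint l.support r.support := by
  rw [support, support, List.disjoint_toFinset_iff_disjoint]
  exact List.disjoint_of_nodup_append h

lemma lcaSize_node_left (l r : HTree n) {i j : Fin n} (hi : i ∈ l.support)
    (hj : j ∈ l.support) : (node l r).lcaSize i j = l.lcaSize i j := by
  simp only [support, List.mem_toFinset] at hi hj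
  simp [lcaSize, hi, hj]

lemma lcaSize_node_right {l r : HTree n} (h : (node l r).leaves.Nodup) {i j : Fin n}
    (hi : i ∈ r.support) (hj : j ∈ r.support) :
    (node l r).lcaSize i j = r.lcaSize i j := by
  have hi' := Finset.disjoint_right.1 (disjoint_support h) hi
  simp only [support, List.mem_toFinset] at hi hj hi'
  simp [lcaSize, hi, hj, hi']

lemma lcaSize_node_left_right {l r : HTree n} (h : (node l r).leaves.Nodup) {i j : Fin n}
    (hi : i ∈ l.support) (hj : j ∈ r.support) :
    (node l r).lcaSize i j = l.size + r.size := by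
  have hi' := Finset.disjoint_left.1 (disjoint_support h) hi
  have hj' := Finset.disjoint_right.1 (disjoint_support h) hj
  simp only [support, List.mem_toFinset] at hi' hj'
  simp [lcaSize, hi', hj']

lemma lcaSize_node_right_left {l r : HTree n} (h : (node l r).leaves.Nodup) {i j : Fin n}
    (hi : i ∈ r.support) (hj : j ∈ l.support) :
    (node l r).lcaSize i j = l.size + r.size := by
  have hi' := Finset.disjoint_right.1 (disjoint_support h) hi
  have hj' := Finset.disjoint_left.1 (disjoint_support h) hj
  simp only [support, List.mem_toFinset] at hi' hj'
  simp [lcaSize, hi', hj']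

lemma lcaSize_self {t : HTree n} (ht : t.leaves.Nodup) {i : Fin n} (hi : i ∈ t.support) :
    t.lcaSize i i = 1 := by
  induction t with
  | leaf j => simp [lcaSize]
  | node l r hl hr =>
    have h := ht
    rw [leaves, List.nodup_append] at h
    rw [support_node, Finset.mem_union] at hi
    rcases hi with hi | hi
    · rw [lcaSize_node_left l r hi hi, hl h.1 hi]
    · rw [lcaSize_node_right ht hi hi, hr h.2.1 hi]

/-- The sum of `|H(i ∨ j)|` over ordered pairs depends only on the number of leaves. -/
lemma sum_lcaSize {t : HTree n} (ht : t.leaves.Nodup) :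
    3 * ∑ i ∈ t.support, ∑ j ∈ t.support, (t.lcaSize i j : ℤ) =
      2 * (t.size : ℤ) ^ 3 + t.size := by
  induction t with
  | leaf j => simp [lcaSize, support, size, leaves]
  | node l r hl hr =>
    have h := ht
    rw [leaves, List.nodup_append] at h
    have hd := disjoint_support ht
    have h1 : ∑ i ∈ l.support, ∑ j ∈ l.support, ((node l r).lcaSize i j : ℤ) =
        ∑ i ∈ l.support, ∑ j ∈ l.support, (l.lcaSize i j : ℤ) :=
      Finset.sum_congr rfl fun i hi => Finset.sum_congr rfl fun j hj => by
        rw [lcaSize_node_left l r hi hj]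
    have h2 : ∑ i ∈ r.support, ∑ j ∈ r.support, ((node l r).lcaSize i j : ℤ) =
        ∑ i ∈ r.support, ∑ j ∈ r.support, (r.lcaSize i j : ℤ) :=
      Finset.sum_congr rfl fun i hi => Finset.sum_congr rfl fun j hj => by
        rw [lcaSize_node_right ht hi hj]
    have h3 : ∑ i ∈ l.support, ∑ j ∈ r.support, ((node l r).lcaSize i j : ℤ) =
        ∑ i ∈ l.support, ∑ j ∈ r.support, ((l.size : ℤ) + r.size) :=
      Finset.sum_congr rfl fun i hi => Finset.sum_congr rfl fun j hj => by
        rw [lcaSize_node_left_right ht hi hj]; push_cast; rfl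
    have h4 : ∑ i ∈ r.support, ∑ j ∈ l.support, ((node l r).lcaSize i j : ℤ) =
        ∑ i ∈ r.support, ∑ j ∈ l.support, ((l.size : ℤ) + r.size) :=
      Finset.sum_congr rfl fun i hi => Finset.sum_congr rfl fun j hj => by
        rw [lcaSize_node_right_left ht hi hj]; push_cast; rfl
    simp only [support_node, Finset.sum_union hd, Finset.sum_add_distrib, h1, h2, h3, h4]
    simp only [Finset.sum_const, card_support h.1, card_support h.2.1, nsmul_eq_mul, size_node]
    have e1 := hl h.1
    have e2 := hr h.2.1
    push_cast
    linear_combination e1 + e2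

/-- The contribution of `(i,j,k)` to `Trev(t, T(t))`, where `T(t)` is the induced triplet set. -/
def gain (t : HTree n) (i j k : Fin n) : ℤ :=
  if i ≠ j ∧ i ≠ k ∧ j ≠ k ∧ t.lcaSize i j < min (t.lcaSize i k) (t.lcaSize j k) then
    (t.lcaSize i k : ℤ) - t.lcaSize i j else 0

lemma gain_nonneg (t : HTree n) (i j k : Fin n) : 0 ≤ t.gain i j k := by
  unfold gain
  split_ifs with h
  · have := lt_min_iff.1 h.2.2.2
    omega
  · exact le_rfl

/-- The gain of triplets whose pair lies in a subtree with leaves `A`, of size `a`, and whose third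
entry lies among the leaves `B` of the sibling subtree. -/
lemma sum_cross {A B : Finset (Fin n)} {t s : HTree n} (hs : s.leaves.Nodup) (hA : s.support = A)
    (h : ∀ i ∈ A, ∀ j ∈ A, ∀ k ∈ B,
      t.gain i j k = if i = j then 0 else (s.size + B.card : ℤ) - s.lcaSize i j) :
    3 * ∑ i ∈ A, ∑ j ∈ A, ∑ k ∈ B, t.gain i j k =
      B.card * (3 * (s.size : ℤ) ^ 2 * (s.size + B.card) - (2 * (s.size : ℤ) ^ 3 + s.size)
        - 3 * s.size * (s.size + B.card - 1)) := by
  have h1 : ∑ i ∈ A, ∑ j ∈ A, ∑ k ∈ B, t.gain i j k =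
      B.card * ∑ i ∈ A, ∑ j ∈ A, (((s.size + B.card : ℤ) - s.lcaSize i j)
        - if i = j then (s.size + B.card - 1 : ℤ) else 0) := by
    rw [Finset.mul_sum]
    refine Finset.sum_congr rfl fun i hi => ?_
    rw [Finset.mul_sum]
    refine Finset.sum_congr rfl fun j hj => ?_
    rw [Finset.sum_congr rfl fun k hk => h i hi j hj k hk]
    rw [Finset.sum_const, nsmul_eq_mul]
    congr 1
    split_ifs with hij
    · subst hij
      rw [lcaSize_self hs (hA ▸ hi)]
      push_cast; ring
    · ring
  have h2 := sum_lcaSize hs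
  have hc := card_support hs
  rw [hA] at h2 hc
  rw [h1]
  simp only [Finset.sum_sub_distrib, Finset.sum_const, hc, nsmul_eq_mul]
  have h3 : ∑ i ∈ A, ∑ j ∈ A, (if i = j then (s.size + B.card - 1 : ℤ) else 0) =
      s.size * (s.size + B.card - 1) := by
    rw [Finset.sum_congr rfl fun i hi => (Finset.sum_ite_eq A i _).trans (if_pos hi)]
    simp [hc]
    ring
  rw [h3]
  linear_combination - (B.card : ℤ) * h2

/-- The revenue of a hierarchy on its own induced triplets is minimized by caterpillars. -/
lemma le_sum_gain {t : HTree n} (ht : t.leaves.Nodup) :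
    ((t.size : ℤ) + 1) * t.size * (t.size - 1) * (t.size - 2) ≤
      12 * ∑ i ∈ t.support, ∑ j ∈ t.support, ∑ k ∈ t.support, t.gain i j k := by
  induction t with
  | leaf j => simp [gain, support, size, leaves]
  | node l r hl hr =>
    have h := ht
    rw [leaves, List.nodup_append] at h
    have hd := disjoint_support ht
    have cl := card_support h.1
    have cr := card_support h.2.1
    have l1 := l.one_le_size
    have r1 := r.one_le_size
    have e1 := hl h.1
    have e2 := hr h.2.1
    have h1 : ∑ i ∈ l.support, ∑ j ∈ l.support, ∑ k ∈ l.support, (node l r).gain i j k =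
        ∑ i ∈ l.support, ∑ j ∈ l.support, ∑ k ∈ l.support, l.gain i j k :=
      Finset.sum_congr rfl fun i hi => Finset.sum_congr rfl fun j hj =>
        Finset.sum_congr rfl fun k hk => by
          simp only [gain, lcaSize_node_left l r hi hj, lcaSize_node_left l r hi hk,
            lcaSize_node_left l r hj hk]
    have h2 : ∑ i ∈ r.support, ∑ j ∈ r.support, ∑ k ∈ r.support, (node l r).gain i j k =
        ∑ i ∈ r.support, ∑ j ∈ r.support, ∑ k ∈ r.support, r.gain i j k :=
      Finset.sum_congr rfl fun i hi => Finset.sum_congr rfl fun j hj =>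
        Finset.sum_congr rfl fun k hk => by
          simp only [gain, lcaSize_node_right ht hi hj, lcaSize_node_right ht hi hk,
            lcaSize_node_right ht hj hk]
    have h3 := sum_cross (A := l.support) (B := r.support) (t := node l r) h.1 rfl (by
      intro i hi j hj k hk
      have ik : i ≠ k := fun e => Finset.disjoint_left.1 hd hi (e ▸ hk)
      have jk : j ≠ k := fun e => Finset.disjoint_left.1 hd hj (e ▸ hk)
      have hle := l.lcaSize_le_size i j
      have hlt : l.lcaSize i j < l.size + r.size := by omega
      by_cases hij : i = j
      · simp [gain, hij]
      · simp [gain, hij, ik, jk, lcaSize_node_left l r hi hj,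
          lcaSize_node_left_right ht hi hk, lcaSize_node_left_right ht hj hk, hlt, cr])
    have h4 := sum_cross (A := r.support) (B := l.support) (t := node l r) h.2.1 rfl (by
      intro i hi j hj k hk
      have ik : i ≠ k := fun e => Finset.disjoint_left.1 hd hk (e ▸ hi)
      have jk : j ≠ k := fun e => Finset.disjoint_left.1 hd hk (e ▸ hj)
      have hle := r.lcaSize_le_size i j
      have hlt : r.lcaSize i j < l.size + r.size := by omega
      by_cases hij : i = j
      · simp [gain, hij]
      · simp [gain, hij, ik, jk, lcaSize_node_right ht hi hj,
          lcaSize_node_right_left ht hi hk, lcaSize_node_right_left ht hj hk, hlt, cl, add_comm])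
    have nn : ∀ A B C : Finset (Fin n),
        0 ≤ ∑ i ∈ A, ∑ j ∈ B, ∑ k ∈ C, (node l r).gain i j k := fun A B C =>
      Finset.sum_nonneg fun i _ => Finset.sum_nonneg fun j _ =>
        Finset.sum_nonneg fun k _ => gain_nonneg _ i j k
    have n1 := nn l.support r.support l.support
    have n2 := nn l.support r.support r.support
    have n3 := nn r.support l.support l.support
    have n4 := nn r.support l.support r.support
    simp only [support_node, Finset.sum_union hd, Finset.sum_add_distrib, size_node, Nat.cast_add]
    rw [cl] at h4
    rw [cr] at h3
    rw [h1, h2]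
    obtain ⟨a, ha⟩ := Nat.exists_eq_add_of_le l1
    obtain ⟨b, hb⟩ := Nat.exists_eq_add_of_le r1
    rw [ha] at e1 h3 h4 ⊢
    rw [hb] at e2 h3 h4 ⊢
    push_cast at *
    have q : (0 : ℤ) ≤ (a : ℤ) * b * (1 + a) * (1 + b) := by positivity
    nlinarith

end HTree

lemma IsHierarchy.support_eq {n : ℕ} {H : HTree n} (hH : IsHierarchy H) :
    H.support = Finset.univ := by
  ext i
  simpa [HTree.support] using hH.2 i

lemma IsHierarchy.size_eq {n : ℕ} {H : HTree n} (hH : IsHierarchy H) : H.size = n := by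
  rw [← HTree.card_support hH.1, hH.support_eq, Finset.card_univ, Fintype.card_fin]

lemma Trev_inducedTriplets_self {n : ℕ} {H : HTree n} (hH : IsHierarchy H) :
    Trev H (inducedTriplets H) =
      ∑ i ∈ H.support, ∑ j ∈ H.support, ∑ k ∈ H.support, H.gain i j k := by
  rw [Trev, inducedTriplets, Finset.sum_filter, Fintype.sum_prod_type, hH.support_eq]
  simp only [Fintype.sum_prod_type]
  rfl

lemma pow_four_le_Trev_self {n : ℕ} {H : HTree n} (hH : IsHierarchy H) (hn : 16 ≤ n) :
    (n : ℝ) ^ 4 / 14 ≤ Trev H (inducedTriplets H) := by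
  have h := HTree.le_sum_gain hH.1
  rw [← Trev_inducedTriplets_self hH, hH.size_eq] at h
  obtain ⟨m, rfl⟩ := Nat.exists_eq_add_of_le hn
  have h' : ((((16 + m : ℕ) : ℤ) + 1) * (16 + m : ℕ) * ((16 + m : ℕ) - 1) * ((16 + m : ℕ) - 2) : ℝ)
      ≤ 12 * (Trev H (inducedTriplets H) : ℝ) := by exact_mod_cast h
  push_cast at h' ⊢
  have hm : (0 : ℝ) ≤ m := Nat.cast_nonneg m
  have h2 : (0 : ℝ) ≤ (m : ℝ) ^ 2 := by positivity
  have h3 : (0 : ℝ) ≤ (m : ℝ) ^ 3 := by positivity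
  have h4 : (0 : ℝ) ≤ (m : ℝ) ^ 4 := by positivity
  nlinarith

lemma flipKey_flipTriplet {n : ℕ} (t : Triplet n) : flipKey (flipTriplet t) = flipKey t := by
  simp [flipKey, flipTriplet, min_comm, max_comm]

lemma flipKey_injOn {n : ℕ} (H0 : HTree n) :
    Set.InjOn (flipKey (n := n)) (inducedTriplets H0) := by
  rintro ⟨i, j, k⟩ h ⟨i', j', k'⟩ h' e
  simp only [inducedTriplets, Finset.coe_filter, Finset.mem_univ, true_and, Set.mem_ofPred_eq,
    lt_min_iff] at h h'
  simp only [flipKey, Prod.mk.injEq] at e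
  obtain ⟨rfl, e1, e2⟩ := e
  have h1 := h.2.2.2.1
  have h1' := h'.2.2.2.1
  rcases le_total j k with a | a <;> rcases le_total j' k' with b | b <;>
    simp only [min_eq_left, min_eq_right, max_eq_left, max_eq_right, a, b] at e1 e2 <;>
    subst e1 e2
  · rfl
  · omega
  · omega
  · rfl

lemma card_filter_pairKey_le {n : ℕ} (T : Finset (Triplet n)) (b : Triplet n) :
    (T.filter fun t => pairKey t = b).card ≤ 2 := by
  refine (Finset.card_le_card (t := {b, (b.2.1, b.1, b.2.2)}) ?_).trans Finset.card_le_two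
  rintro ⟨i, j, k⟩ h
  obtain ⟨-, rfl⟩ := Finset.mem_filter.1 h
  rcases le_total i j with a | a <;> simp [pairKey, a]

/-- Value of a sampling coin. -/
def keepVal (b : Bool) : ℝ := if b = true then 1 else 0

/-- Sign by which a flipping coin multiplies the revenue of a triplet. -/
def flipSign (b : Bool) : ℝ := if b = true then -1 else 1

/-- Revenue of a single triplet. -/
def weight {n : ℕ} (g : Fin n → Fin n → ℕ) (t : Triplet n) : ℝ :=
  (g t.1 t.2.2 : ℝ) - g t.1 t.2.1

lemma Trev_eq_sum_weight {n : ℕ} (H : HTree n) (T : Finset (Triplet n)) :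
    (Trev H T : ℝ) = ∑ t ∈ T, weight H.lcaSize t := by
  simp [Trev, weight]

lemma Trev_noisySampledT {n : ℕ} (H0 H : HTree n) (ω : (Triplet n ⊕ Triplet n) → Bool) :
    (Trev H (noisySampledT H0 ω) : ℝ) = ∑ t ∈ inducedTriplets H0,
      keepVal (ω (Sum.inl (pairKey t))) * flipSign (ω (Sum.inr (flipKey t))) *
        weight H.lcaSize t := by
  rw [Trev_eq_sum_weight, noisySampledT, Finset.sum_image, Finset.sum_filter]
  · refine Finset.sum_congr rfl fun t _ => ?_
    cases ω (Sum.inl (pairKey t)) <;> cases ω (Sum.inr (flipKey t)) <;>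
      simp [keepVal, flipSign, weight, flipTriplet]
  · intro t ht t' ht' e
    refine flipKey_injOn H0 (Finset.mem_filter.1 ht).1 (Finset.mem_filter.1 ht').1 ?_
    have key : ∀ s : Triplet n, flipKey (if ω (Sum.inr (flipKey s)) = true then flipTriplet s
        else s) = flipKey s := fun s => by
      split_ifs
      · exact flipKey_flipTriplet s
      · rfl
    rw [← key t, ← key t']
    exact congrArg flipKey e

lemma isProbabilityMeasure_bern {p : ℝ} (h0 : 0 ≤ p) (h1 : p ≤ 1) :
    IsProbabilityMeasure (bern p) := by
  constructor
  simp only [bern, Measure.add_apply, Measure.smul_apply, measure_univ, smul_eq_mul, mul_one]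
  rw [← ENNReal.ofReal_add h0 (by linarith)]
  simp

lemma integral_bern {p : ℝ} (h0 : 0 ≤ p) (h1 : p ≤ 1) (f : Bool → ℝ) :
    ∫ b, f b ∂bern p = p * f true + (1 - p) * f false := by
  rw [bern, integral_add_measure (Integrable.of_finite.smul_measure ENNReal.ofReal_ne_top)
    (Integrable.of_finite.smul_measure ENNReal.ofReal_ne_top)]
  simp [integral_smul_measure, ENNReal.toReal_ofReal, h0, h1]

lemma exp_le_quadratic {x : ℝ} (hx : |x| ≤ 1 / 10) :
    Real.exp x ≤ 1 + x + 3 / 5 * x ^ 2 := by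
  have h := Real.exp_bound (x := x) (by linarith) (n := 3) (by norm_num)
  simp only [Finset.sum_range_succ, Finset.sum_range_zero, Nat.factorial] at h
  have h' := (abs_le.1 h).2
  norm_num at h'
  have : |x| ^ 3 ≤ 1 / 10 * x ^ 2 := by
    rw [pow_succ, sq_abs, mul_comm]
    exact mul_le_mul_of_nonneg_right hx (sq_nonneg x)
  nlinarith [sq_nonneg x]

lemma integral_exp_bern_le {p : ℝ} (h0 : 0 ≤ p) (h1 : p ≤ 1) {φ : Bool → ℝ}
    (hφ : ∀ b, |φ b| ≤ 1) {m m₂ : ℝ} (hm : p * φ true + (1 - p) * φ false = m)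
    (hm₂ : p * φ true ^ 2 + (1 - p) * φ false ^ 2 = m₂) {u : ℝ} (hu : |u| ≤ 1 / 10) :
    ∫ b, Real.exp (φ b * u) ∂bern p ≤ Real.exp (m * u + 3 / 5 * m₂ * u ^ 2) := by
  have hb : ∀ b, Real.exp (φ b * u) ≤ 1 + φ b * u + 3 / 5 * (φ b * u) ^ 2 := fun b =>
    exp_le_quadratic (by
      rw [abs_mul]
      calc |φ b| * |u| ≤ 1 * |u| := mul_le_mul_of_nonneg_right (hφ b) (abs_nonneg u)
        _ ≤ 1 / 10 := by rwa [one_mul])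
  rw [integral_bern h0 h1]
  have a1 := mul_le_mul_of_nonneg_left (hb true) h0
  have a2 := mul_le_mul_of_nonneg_left (hb false) (sub_nonneg.2 h1)
  have a3 := Real.add_one_le_exp (m * u + 3 / 5 * m₂ * u ^ 2)
  rw [← hm, ← hm₂] at a3 ⊢
  linarith

/-- Exponential moment bound for a sum over `T` of weighted Bernoulli coins, where each coin is
shared by at most `N` elements of `T`. -/
lemma integral_exp_pi_bern_le {ι κ : Type*} [Fintype κ] [DecidableEq κ] (T : Finset ι)
    (key : ι → κ) {p : ℝ} (h0 : 0 ≤ p) (h1 : p ≤ 1) {φ : Bool → ℝ} (hφ : ∀ b, |φ b| ≤ 1)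
    {m m₂ : ℝ} (hm : p * φ true + (1 - p) * φ false = m)
    (hm₂ : p * φ true ^ 2 + (1 - p) * φ false ^ 2 = m₂) {N : ℕ}
    (hN : ∀ b, (T.filter fun t => key t = b).card ≤ N) {u : ι → ℝ}
    (hu : ∀ t ∈ T, N * |u t| ≤ 1 / 10) :
    ∫ ω : κ → Bool, Real.exp (∑ t ∈ T, φ (ω (key t)) * u t) ∂Measure.pi (fun _ => bern p) ≤
      Real.exp (m * ∑ t ∈ T, u t + 3 / 5 * m₂ * N * ∑ t ∈ T, u t ^ 2) := by
  have := isProbabilityMeasure_bern h0 h1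
  have hm₂0 : 0 ≤ m₂ := by
    rw [← hm₂]
    have := sub_nonneg.2 h1
    positivity
  set U : κ → ℝ := fun b => ∑ t ∈ T with key t = b, u t with hU
  have e1 : ∀ ω : κ → Bool, Real.exp (∑ t ∈ T, φ (ω (key t)) * u t) =
      ∏ b, Real.exp (φ (ω b) * U b) := fun ω => by
    rw [← Real.exp_sum, ← Finset.sum_fiberwise T key]
    congr 1
    refine Finset.sum_congr rfl fun b _ => ?_
    rw [Finset.mul_sum]
    refine Finset.sum_congr rfl fun t ht => ?_
    rw [(Finset.mem_filter.1 ht).2]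
  have hUb : ∀ b, |U b| ≤ 1 / 10 := fun b => by
    rcases Nat.eq_zero_or_pos N with rfl | hpos
    · have : (T.filter fun t => key t = b) = ∅ := Finset.card_eq_zero.1 (Nat.le_zero.1 (hN b))
      simp [hU, this]
    · have hN' : (0 : ℝ) < N := Nat.cast_pos.2 hpos
      calc |U b| ≤ ∑ t ∈ T with key t = b, |u t| := Finset.abs_sum_le_sum_abs _ _
        _ ≤ ∑ t ∈ T with key t = b, (1 / 10 / N : ℝ) := Finset.sum_le_sum fun t ht => by
            rw [le_div_iff₀ hN', mul_comm]
            exact hu t (Finset.mem_filter.1 ht).1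
        _ = (T.filter fun t => key t = b).card * (1 / 10 / N : ℝ) := by
            rw [Finset.sum_const, nsmul_eq_mul]
        _ ≤ N * (1 / 10 / N : ℝ) := by
            gcongr
            exact hN b
        _ = 1 / 10 := by field_simp
  simp_rw [e1]
  rw [integral_fintype_prod_eq_prod (fun b x => Real.exp (φ x * U b))]
  calc ∏ b, ∫ x, Real.exp (φ x * U b) ∂bern p
      ≤ ∏ b, Real.exp (m * U b + 3 / 5 * m₂ * U b ^ 2) :=
        Finset.prod_le_prod (fun b _ => integral_nonneg fun x => (Real.exp_pos _).le)
          fun b _ => integral_exp_bern_le h0 h1 hφ hm hm₂ (hUb b)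
    _ = Real.exp (m * ∑ b, U b + 3 / 5 * m₂ * ∑ b, U b ^ 2) := by
        rw [← Real.exp_sum, Finset.sum_add_distrib, ← Finset.mul_sum, ← Finset.mul_sum]
    _ ≤ _ := by
        rw [Real.exp_le_exp, mul_assoc _ (N : ℝ), hU, Finset.sum_fiberwise T key u]
        gcongr
        rw [← Finset.sum_fiberwise T key (fun t => u t ^ 2), Finset.mul_sum]
        refine Finset.sum_le_sum fun b _ => ?_
        refine (sq_sum_le_card_mul_sum_sq (s := T.filter fun t => key t = b) (f := u)).trans ?_
        have := hN b
        gcongr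

lemma integral_noisyMeasure {n : ℕ} {p δ : ℝ} (hp0 : 0 ≤ p) (hp1 : p ≤ 1) (hδ0 : 0 ≤ δ)
    (hδ1 : δ ≤ 1) (f : (Triplet n → Bool) → (Triplet n → Bool) → ℝ) :
    ∫ ω, f (fun t => ω (Sum.inl t)) (fun t => ω (Sum.inr t)) ∂noisyMeasure n p δ =
      ∫ s, ∫ z, f s z ∂Measure.pi (fun _ => bern δ) ∂Measure.pi (fun _ => bern p) := by
  have := isProbabilityMeasure_bern hp0 hp1
  have := isProbabilityMeasure_bern hδ0 hδ1
  have hprob : ∀ i : Triplet n ⊕ Triplet n, IsProbabilityMeasure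
      (Sum.elim (fun _ : Triplet n => bern p) (fun _ : Triplet n => bern δ) i) := by
    rintro (i | i) <;> simpa
  have h := (measurePreserving_sumPiEquivProdPi (X := fun _ : Triplet n ⊕ Triplet n => Bool)
    (fun i => Sum.elim (fun _ : Triplet n => bern p) (fun _ : Triplet n => bern δ) i)).integral_comp'
    (fun x => f x.1 x.2)
  rw [noisyMeasure]
  refine h.trans ?_
  exact integral_prod _ Integrable.of_finite

lemma isProbabilityMeasure_noisyMeasure {n : ℕ} {p δ : ℝ} (hp0 : 0 ≤ p) (hp1 : p ≤ 1)
    (hδ0 : 0 ≤ δ) (hδ1 : δ ≤ 1) : IsProbabilityMeasure (noisyMeasure n p δ) := by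
  have := isProbabilityMeasure_bern hp0 hp1
  have := isProbabilityMeasure_bern hδ0 hδ1
  have hprob : ∀ i : Triplet n ⊕ Triplet n, IsProbabilityMeasure
      (Sum.elim (fun _ : Triplet n => bern p) (fun _ : Triplet n => bern δ) i) := by
    rintro (i | i) <;> simpa
  rw [noisyMeasure]
  infer_instance

lemma card_inducedTriplets_le {n : ℕ} (H : HTree n) :
    ((inducedTriplets H).card : ℝ) ≤ (n : ℝ) ^ 3 := by
  have h := Finset.card_le_univ (inducedTriplets H)
  simp only [Fintype.card_prod, Fintype.card_fin] at h
  calc ((inducedTriplets H).card : ℝ) ≤ ((n * (n * n) : ℕ) : ℝ) := by exact_mod_cast h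
    _ = (n : ℝ) ^ 3 := by push_cast; ring

/-- Exponential moment bound for the revenue of a noisy random triplet set. -/
lemma integral_exp_noisy_le {n : ℕ} (H0 : HTree n) {p δ : ℝ} (hp0 : 0 ≤ p) (hp1 : p ≤ 1)
    (hδ0 : 0 ≤ δ) (hδ1 : δ ≤ 1 / 2) {d : ℝ} (hd : d ≤ 1 / 224) {u : Triplet n → ℝ}
    (hu : ∀ t ∈ inducedTriplets H0, |u t| ≤ d) :
    ∫ ω, Real.exp (∑ t ∈ inducedTriplets H0,
        keepVal (ω (Sum.inl (pairKey t))) * flipSign (ω (Sum.inr (flipKey t))) * u t)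
        ∂noisyMeasure n p δ ≤
      Real.exp (p * ((1 - 2 * δ) * ∑ t ∈ inducedTriplets H0, u t
        + 2 * (n : ℝ) ^ 3 * d ^ 2)) := by
  set T := inducedTriplets H0 with hT
  set v : Triplet n → ℝ := fun t => (1 - 2 * δ) * u t + 3 / 5 * u t ^ 2 with hv
  have hinner : ∀ s : Triplet n → Bool,
      ∫ z, Real.exp (∑ t ∈ T, keepVal (s (pairKey t)) * flipSign (z (flipKey t)) * u t)
        ∂Measure.pi (fun _ => bern δ) ≤ Real.exp (∑ t ∈ T, keepVal (s (pairKey t)) * v t) := by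
    intro s
    have h := integral_exp_pi_bern_le (κ := Triplet n) T flipKey hδ0 (by linarith : δ ≤ 1)
      (φ := flipSign) (by intro b; cases b <;> simp [flipSign]) (m := 1 - 2 * δ) (m₂ := 1)
      (by simp only [flipSign]; norm_num; ring) (by simp only [flipSign]; norm_num) (N := 1)
      (fun b => Finset.card_le_one.2 fun t ht t' ht' => by
        rw [Finset.mem_filter] at ht ht'
        exact flipKey_injOn H0 ht.1 ht'.1 (ht.2.trans ht'.2.symm))
      (u := fun t => keepVal (s (pairKey t)) * u t) (by
        intro t ht
        have := hu t ht
        have h0 := abs_nonneg (u t)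
        cases s (pairKey t) <;> simp [keepVal]
        linarith)
    refine (le_of_eq ?_).trans (h.trans (le_of_eq ?_))
    · congr 1; funext z
      congr 1
      exact Finset.sum_congr rfl fun t _ => by ring
    · rw [Finset.mul_sum, Finset.mul_sum, ← Finset.sum_add_distrib]
      congr 1
      refine Finset.sum_congr rfl fun t _ => ?_
      cases s (pairKey t) <;> simp [keepVal, hv]
  have hvd : ∀ t ∈ T, |v t| ≤ 101 / 100 * d := fun t ht => by
    have h1 := hu t ht
    have h0 := abs_nonneg (u t)
    have h2 : |(1 - 2 * δ) * u t| ≤ d := by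
      rw [abs_mul, abs_of_nonneg (by linarith)]
      nlinarith
    have h3 : |3 / 5 * u t ^ 2| ≤ 3 / 5 * d ^ 2 := by
      rw [abs_of_nonneg (by positivity), ← sq_abs]
      gcongr
    have h4 := abs_add_le ((1 - 2 * δ) * u t) (3 / 5 * u t ^ 2)
    nlinarith
  have houter := integral_exp_pi_bern_le (κ := Triplet n) T pairKey hp0 hp1
      (φ := keepVal) (by intro b; cases b <;> simp [keepVal]) (m := p) (m₂ := p)
      (by simp [keepVal]) (by simp [keepVal]) (N := 2)
      (card_filter_pairKey_le T) (u := v) (by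
        intro t ht
        have := hvd t ht
        push_cast
        linarith)
  rw [integral_noisyMeasure hp0 hp1 hδ0 (by linarith) (fun s z => Real.exp (∑ t ∈ T,
        keepVal (s (pairKey t)) * flipSign (z (flipKey t)) * u t))]
  have := isProbabilityMeasure_bern hp0 hp1
  refine (integral_mono Integrable.of_finite Integrable.of_finite hinner).trans
    (houter.trans (Real.exp_le_exp.2 ?_))
  have hc := card_inducedTriplets_le H0
  rw [← hT] at hc
  have s1 : ∑ t ∈ T, u t ^ 2 ≤ (n : ℝ) ^ 3 * d ^ 2 :=
    calc ∑ t ∈ T, u t ^ 2 ≤ ∑ t ∈ T, d ^ 2 := Finset.sum_le_sum fun t ht => by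
          rw [← sq_abs]; have := hu t ht; gcongr
      _ = T.card * d ^ 2 := by rw [Finset.sum_const, nsmul_eq_mul]
      _ ≤ _ := by gcongr
  have s2 : ∑ t ∈ T, v t ^ 2 ≤ (n : ℝ) ^ 3 * (101 / 100 * d) ^ 2 :=
    calc ∑ t ∈ T, v t ^ 2 ≤ ∑ t ∈ T, (101 / 100 * d) ^ 2 := Finset.sum_le_sum fun t ht => by
          rw [← sq_abs]; have := hvd t ht; gcongr
      _ = T.card * (101 / 100 * d) ^ 2 := by rw [Finset.sum_const, nsmul_eq_mul]
      _ ≤ _ := by gcongr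
  have s3 : ∑ t ∈ T, v t = (1 - 2 * δ) * ∑ t ∈ T, u t + 3 / 5 * ∑ t ∈ T, u t ^ 2 := by
    simp only [hv, Finset.sum_add_distrib, Finset.mul_sum]
  have s4 : 0 ≤ (n : ℝ) ^ 3 * d ^ 2 := by positivity
  rw [s3]
  push_cast
  have s5 : 3 / 5 * ∑ t ∈ T, u t ^ 2 + 6 / 5 * ∑ t ∈ T, v t ^ 2 ≤ 2 * (n : ℝ) ^ 3 * d ^ 2 := by
    nlinarith
  nlinarith [mul_le_mul_of_nonneg_left s5 hp0]

lemma measureReal_nonneg_le_integral_exp {Ω : Type*} [Finite Ω] [MeasurableSpace Ω]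
    [MeasurableSingletonClass Ω] (μ : Measure Ω) [IsFiniteMeasure μ] (Y : Ω → ℝ) :
    μ.real {ω | 0 ≤ Y ω} ≤ ∫ ω, Real.exp (Y ω) ∂μ := by
  have h := mul_meas_ge_le_integral_of_nonneg (μ := μ) (f := fun ω => Real.exp (Y ω))
    (ae_of_all _ fun ω => (Real.exp_pos _).le) Integrable.of_finite 1
  rw [one_mul] at h
  refine le_trans (measureReal_mono ?_) h
  intro ω hω
  exact Real.one_le_exp hω

/-- A fixed family of lca sizes with revenue at most `(1 - ε)` times optimal is unlikely to beat
the ground truth on the noisy sample. -/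
lemma measureReal_weight_ge_le {n : ℕ} {H0 : HTree n} (hH0 : IsHierarchy H0) {p δ ε : ℝ}
    (hp0 : 0 ≤ p) (hp1 : p ≤ 1) (hδ0 : 0 ≤ δ) (hδ1 : δ ≤ 1 / 2) (hε0 : 0 ≤ ε) (hε : ε ≤ 1 / 2)
    (hn : 16 ≤ n) {g : Fin n → Fin n → ℕ} (hg : ∀ i j, 1 ≤ g i j ∧ g i j ≤ n)
    (hbad : ∑ t ∈ inducedTriplets H0, weight g t ≤
      (1 - ε) * (Trev H0 (inducedTriplets H0) : ℝ)) :
    (noisyMeasure n p δ).real {ω | ∑ t ∈ inducedTriplets H0,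
        keepVal (ω (Sum.inl (pairKey t))) * flipSign (ω (Sum.inr (flipKey t))) *
          weight H0.lcaSize t ≤
      ∑ t ∈ inducedTriplets H0,
        keepVal (ω (Sum.inl (pairKey t))) * flipSign (ω (Sum.inr (flipKey t))) * weight g t} ≤
      Real.exp (-(p * (1 - 2 * δ) ^ 2 * ε ^ 2 * (n : ℝ) ^ 3 / 6272)) := by
  have := isProbabilityMeasure_noisyMeasure (n := n) hp0 hp1 hδ0 (by linarith)
  have hn0 : (0 : ℝ) < n := by exact_mod_cast (by omega : 0 < n)
  set q := 1 - 2 * δ with hq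
  have hq0 : 0 ≤ q := by linarith
  have hq1 : q ≤ 1 := by linarith
  set T := inducedTriplets H0 with hT
  set lam := q * ε / (224 * n) with hlam
  have hlam0 : 0 ≤ lam := by positivity
  have hlamn : lam * n = q * ε / 224 := by rw [hlam]; field_simp
  have hw : ∀ f : Fin n → Fin n → ℕ, (∀ i j, 1 ≤ f i j ∧ f i j ≤ n) → ∀ t, |weight f t| ≤ n := by
    intro f hf t
    have h1 : (f t.1 t.2.2 : ℝ) ≤ n := by exact_mod_cast (hf t.1 t.2.2).2
    have h2 : (f t.1 t.2.1 : ℝ) ≤ n := by exact_mod_cast (hf t.1 t.2.1).2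
    have h3 : (0 : ℝ) ≤ f t.1 t.2.2 := Nat.cast_nonneg _
    have h4 : (0 : ℝ) ≤ f t.1 t.2.1 := Nat.cast_nonneg _
    rw [weight, abs_le]
    constructor <;> linarith
  have hqε : q * ε ≤ 1 / 2 := by nlinarith
  have key := integral_exp_noisy_le H0 hp0 hp1 hδ0 hδ1 (d := 2 * (lam * n))
    (by rw [hlamn]; linarith) (u := fun t => lam * (weight g t - weight H0.lcaSize t)) (by
      intro t _
      have h1 := hw g hg t
      have h2 := hw H0.lcaSize
        (fun i j => ⟨H0.one_le_lcaSize i j, (H0.lcaSize_le_size i j).trans_eq hH0.size_eq⟩) t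
      rw [abs_mul, abs_of_nonneg hlam0]
      have h3 := abs_sub (weight g t) (weight H0.lcaSize t)
      nlinarith)
  have mono := measureReal_nonneg_le_integral_exp (noisyMeasure n p δ)
    (fun ω => ∑ t ∈ T, keepVal (ω (Sum.inl (pairKey t))) * flipSign (ω (Sum.inr (flipKey t))) *
      (lam * (weight g t - weight H0.lcaSize t)))
  refine le_trans (measureReal_mono ?_) (mono.trans (key.trans (Real.exp_le_exp.2 ?_)))
  · intro ω hω
    simp only [Set.mem_ofPred_eq] at hω ⊢
    have := mul_nonneg hlam0 (sub_nonneg.2 hω)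
    rw [← Finset.sum_sub_distrib, Finset.mul_sum] at this
    refine this.trans (le_of_eq (Finset.sum_congr rfl fun t _ => by ring))
  · rw [← Finset.mul_sum, Finset.sum_sub_distrib, ← Trev_eq_sum_weight]
    have hR := pow_four_le_Trev_self hH0 hn
    rw [← hT] at hR
    have h1 : ∑ t ∈ T, weight g t - (Trev H0 T : ℝ) ≤ -(ε * ((n : ℝ) ^ 4 / 14)) := by
      have := mul_le_mul_of_nonneg_left hR hε0
      linarith
    have h2 := mul_le_mul_of_nonneg_left (mul_le_mul_of_nonneg_left h1 hlam0) hq0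
    have h3 : q * (lam * -(ε * ((n : ℝ) ^ 4 / 14))) = -(q ^ 2 * ε ^ 2 * (n : ℝ) ^ 3 / 3136) := by
      have : q * (lam * -(ε * ((n : ℝ) ^ 4 / 14))) = -(q * (lam * n) * ε * (n : ℝ) ^ 3 / 14) := by
        ring
      rw [this, hlamn]; ring
    have h4 : 2 * (n : ℝ) ^ 3 * (2 * (lam * n)) ^ 2 = q ^ 2 * ε ^ 2 * (n : ℝ) ^ 3 / 6272 := by
      rw [hlamn]; ring
    rw [h4]
    rw [h3] at h2
    have h5 : q * (lam * (∑ t ∈ T, weight g t - (Trev H0 T : ℝ))) +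
        q ^ 2 * ε ^ 2 * (n : ℝ) ^ 3 / 6272 ≤ -(q ^ 2 * ε ^ 2 * (n : ℝ) ^ 3 / 6272) := by linarith
    have h6 := mul_le_mul_of_nonneg_left h5 hp0
    linarith

/-- noisy setting: with probability `≥ 1 − n^{−α}`, every hierarchy `Ĥ`
maximizing `Trev(·, T')` satisfies `Trev(Ĥ, T0) ≥ (1−ε)·Trev(H0, T0)`. -/
theorem noisy_sampled_trev_approximation {n : ℕ} (H0 : HTree n) (hH0 : IsHierarchy H0)
    (p δ : ℝ) (hp0 : 0 < p) (hp1 : p ≤ 1) (hδ0 : 0 < δ) (hδ1 : δ < 1 / 2)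
    (α ε : ℝ) (hα : 0 < α) (hε0 : 0 < ε) (hε : ε < 1 / 2) (hn : (n : ℝ) > 8 / ε)
    (hpn : p > 2 ^ 12 * (α + 2) * Real.log n / ((n : ℝ) * ε ^ 2 * (1 - 2 * δ) ^ 2)) :
    ENNReal.ofReal (1 - (n : ℝ) ^ (-α)) ≤
      noisyMeasure n p δ {ω |
        ∀ Hhat : HTree n, IsHierarchy Hhat →
          (∀ H : HTree n, IsHierarchy H →
            Trev H (noisySampledT H0 ω) ≤ Trev Hhat (noisySampledT H0 ω)) →
          (1 - ε) * (Trev H0 (inducedTriplets H0) : ℝ) ≤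
            (Trev Hhat (inducedTriplets H0) : ℝ)} := by
  have hn16 : (16 : ℝ) < n := by
    have : (16 : ℝ) < 8 / ε := by rw [lt_div_iff₀ hε0]; linarith
    linarith
  have hn16' : 16 ≤ n := by exact_mod_cast hn16.le
  have hn0 : (0 : ℝ) < n := by linarith
  have hlog : 0 < Real.log n := Real.log_pos (by linarith)
  have hq0 : 0 < 1 - 2 * δ := by linarith
  set μ := noisyMeasure n p δ with hμ
  have : IsProbabilityMeasure μ := isProbabilityMeasure_noisyMeasure hp0.le hp1 hδ0.le (by linarith)
  set T := inducedTriplets H0 with hT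
  set G := (Fintype.piFinset fun _ : Fin n => Fintype.piFinset fun _ : Fin n =>
    Finset.Icc 1 n) with hG
  set G' := G.filter fun g => ∑ t ∈ T, weight g t ≤ (1 - ε) * (Trev H0 T : ℝ) with hG'
  set E : (Fin n → Fin n → ℕ) → Set ((Triplet n ⊕ Triplet n) → Bool) := fun g =>
    {ω | ∑ t ∈ T, keepVal (ω (Sum.inl (pairKey t))) * flipSign (ω (Sum.inr (flipKey t))) *
          weight H0.lcaSize t ≤
      ∑ t ∈ T, keepVal (ω (Sum.inl (pairKey t))) * flipSign (ω (Sum.inr (flipKey t))) *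
          weight g t} with hE
  have hexp : ((n : ℝ) ^ 2 + α) * Real.log n ≤
      p * (1 - 2 * δ) ^ 2 * ε ^ 2 * (n : ℝ) ^ 3 / 6272 := by
    rw [gt_iff_lt, div_lt_iff₀ (by positivity)] at hpn
    have h1 := mul_le_mul_of_nonneg_left hpn.le (sq_nonneg (n : ℝ))
    have h2 : ((n : ℝ) ^ 2 + α) ≤ (n : ℝ) ^ 2 * (4096 * (α + 2)) / 6272 := by
      have : 256 * α ≤ (n : ℝ) ^ 2 * α := by gcongr; nlinarith
      nlinarith
    have h3 := mul_le_mul_of_nonneg_right h2 hlog.le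
    nlinarith
  have hbound : μ.real (⋃ g ∈ G', E g) ≤ (n : ℝ) ^ (-α) := by
    calc μ.real (⋃ g ∈ G', E g) ≤ ∑ g ∈ G', μ.real (E g) := measureReal_biUnion_finset_le _ _
      _ ≤ ∑ g ∈ G', Real.exp (-(((n : ℝ) ^ 2 + α) * Real.log n)) := by
          refine Finset.sum_le_sum fun g hg => ?_
          rw [hG', Finset.mem_filter, hG] at hg
          refine (measureReal_weight_ge_le hH0 hp0.le hp1 hδ0.le hδ1.le hε0.le hε.le hn16'
            (fun i j => ?_) hg.2).trans (Real.exp_le_exp.2 (neg_le_neg hexp))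
          exact Finset.mem_Icc.1 (Fintype.mem_piFinset.1 (Fintype.mem_piFinset.1 hg.1 i) j)
      _ = G'.card * Real.exp (-(((n : ℝ) ^ 2 + α) * Real.log n)) := by
          rw [Finset.sum_const, nsmul_eq_mul]
      _ ≤ (n : ℝ) ^ (n * n) * Real.exp (-(((n : ℝ) ^ 2 + α) * Real.log n)) := by
          gcongr
          have h1 : G'.card ≤ G.card := Finset.card_filter_le _ _
          have h2 : G.card = n ^ (n * n) := by
            simp [hG, Fintype.card_piFinset, pow_mul]
          rw [h2] at h1
          exact_mod_cast h1
      _ = (n : ℝ) ^ (-α) := by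
          rw [← Real.rpow_natCast, Real.rpow_def_of_pos hn0, Real.rpow_def_of_pos hn0,
            ← Real.exp_add]
          congr 1
          push_cast
          ring
  have hsub : (⋃ g ∈ G', E g)ᶜ ⊆ {ω | ∀ Hhat : HTree n, IsHierarchy Hhat →
      (∀ H : HTree n, IsHierarchy H →
        Trev H (noisySampledT H0 ω) ≤ Trev Hhat (noisySampledT H0 ω)) →
      (1 - ε) * (Trev H0 T : ℝ) ≤ (Trev Hhat T : ℝ)} := by
    intro ω hω Hhat hHhat hmax
    by_contra! hlt
    refine hω (Set.mem_biUnion (x := Hhat.lcaSize) ?_ ?_)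
    · rw [hG', Finset.mem_coe, Finset.mem_filter, ← Trev_eq_sum_weight]
      refine ⟨?_, hlt.le⟩
      simp only [hG, Fintype.mem_piFinset, Finset.mem_Icc]
      exact fun i j => ⟨Hhat.one_le_lcaSize i j, (Hhat.lcaSize_le_size i j).trans_eq hHhat.size_eq⟩
    · have h : (Trev H0 (noisySampledT H0 ω) : ℝ) ≤ Trev Hhat (noisySampledT H0 ω) := by
        exact_mod_cast hmax H0 hH0
      rw [Trev_noisySampledT, Trev_noisySampledT] at h
      exact h
  refine le_trans ?_ (measure_mono hsub)
  rw [← ofReal_measureReal]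
  refine ENNReal.ofReal_le_ofReal ?_
  rw [probReal_compl_eq_one_sub (Set.toFinite _).measurableSet]
  linarith

end CompHC
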